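/- Let Eˢ = E_s¹ N + E_s³ B, Eᶜ = E_ξ¹ N + E_ξ³ B and Eᵉ = E_η¹ N + E_η³ B be electric fields along the three-parameter frame (T,N,B), with ∂_s E_s¹ = ∂_s E_s³ = 0, ∂_ξ E_ξ¹ = ∂_ξ E_ξ³ = 0 and ∂_η E_η¹ = ∂_η E_η³ = 0. Then the contraction ∇·E := ⟨T, ∂_s Eˢ⟩ + ⟨N, ∂_ξ Eᶜ⟩ + ⟨B, ∂_η Eᵉ⟩ satisfies ∇·E = -κ E_s¹ + E_η¹ Υ_NB - E_ξ³ Γ_NB at every point of ℝ³. -/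

import Mathlib

noncomputable section

/-- The pseudo-Euclidean bilinear form of index `v` on `ℝ⁴`:
`⟨x,y⟩ = -∑_{i<v} xᵢyᵢ + ∑_{i≥v} xᵢyᵢ`. -/
def pform (v : ℕ) (x y : Fin 4 → ℝ) : ℝ :=
  ∑ i : Fin 4, (if (i : ℕ) < v then (-1 : ℝ) else 1) * x i * y i

/-- Partial derivative with respect to the first parameter `s`. -/
def pds {E : Type*} [NormedAddCommGroup E] [NormedSpace ℝ E]
    (X : ℝ × ℝ × ℝ → E) (p : ℝ × ℝ × ℝ) : E :=
  deriv (fun t => X (t, p.2.1, p.2.2)) p.1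

/-- Partial derivative with respect to the second parameter `ξ`. -/
def pdxi {E : Type*} [NormedAddCommGroup E] [NormedSpace ℝ E]
    (X : ℝ × ℝ × ℝ → E) (p : ℝ × ℝ × ℝ) : E :=
  deriv (fun t => X (p.1, t, p.2.2)) p.2.1

/-- Partial derivative with respect to the third parameter `η`. -/
def pdeta {E : Type*} [NormedAddCommGroup E] [NormedSpace ℝ E]
    (X : ℝ × ℝ × ℝ → E) (p : ℝ × ℝ × ℝ) : E :=
  deriv (fun t => X (p.1, p.2.1, t)) p.2.2

/-- The anholonomic divergence of a vector field `X` with respect to the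
frame `(T,N,B)`: `Div X = ε₁⟨T,∂ₛX⟩ + ε₂⟨N,∂_ξX⟩ + ε₃⟨B,∂_ηX⟩`. -/
def aDiv (v : ℕ) (ε₁ ε₂ ε₃ : ℝ) (T N B X : ℝ × ℝ × ℝ → Fin 4 → ℝ)
    (p : ℝ × ℝ × ℝ) : ℝ :=
  ε₁ * pform v (T p) (pds X p) + ε₂ * pform v (N p) (pdxi X p)
    + ε₃ * pform v (B p) (pdeta X p)

theorem pform_comm (v : ℕ) (x y : Fin 4 → ℝ) : pform v x y = pform v y x := by
  simp only [pform, mul_right_comm]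

theorem pform_add_right (v : ℕ) (x y z : Fin 4 → ℝ) :
    pform v x (y + z) = pform v x y + pform v x z := by
  simp only [pform, Pi.add_apply, mul_add, Finset.sum_add_distrib]

theorem pform_smul_right (v : ℕ) (a : ℝ) (x y : Fin 4 → ℝ) :
    pform v x (a • y) = a * pform v x y := by
  simp only [pform, Pi.smul_apply, smul_eq_mul, Finset.mul_sum, mul_left_comm _ a]

/-- Coefficients with vanishing derivative can be pulled out of the derivative of a
combination of two differentiable curves. -/
theorem deriv_smul_add_smul_of_hasDerivAt_zero {E : Type*} [NormedAddCommGroup E]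
    [NormedSpace ℝ E] {f g : ℝ → ℝ} {X Y : ℝ → E} {t : ℝ}
    (hf : HasDerivAt f 0 t) (hg : HasDerivAt g 0 t)
    (hX : DifferentiableAt ℝ X t) (hY : DifferentiableAt ℝ Y t) :
    deriv (fun u => f u • X u + g u • Y u) t = f t • deriv X t + g t • deriv Y t := by
  simpa using ((hf.fun_smul hX.hasDerivAt).fun_add (hg.fun_smul hY.hasDerivAt)).deriv

/-- The Maxwell contraction `∇·E := ⟨T,∂ₛEˢ⟩ + ⟨N,∂_ξEᶜ⟩ + ⟨B,∂_ηEᵉ⟩` of the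
electric fields `Eˢ = Eₛ¹N + Eₛ³B`, `Eᶜ = E_ξ¹N + E_ξ³B`, `Eᵉ = E_η¹N + E_η³B`
equals `-κEₛ¹ + E_η¹Υ_NB - E_ξ³Γ_NB`. -/
theorem electric_maxwell_contraction
    (v : ℕ) (hv : v ≤ 2)
    (c ε₁ ε₂ ε₃ : ℝ)
    (hc : c = 1 ∨ c = -1)
    (hε₁ : ε₁ = 1 ∨ ε₁ = -1) (hε₂ : ε₂ = 1 ∨ ε₂ = -1) (hε₃ : ε₃ = 1 ∨ ε₃ = -1)
    (γ T N B : ℝ × ℝ × ℝ → Fin 4 → ℝ)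
    (κ τ ΓTN ΓTB ΓNB ΥTN ΥTB ΥNB : ℝ × ℝ × ℝ → ℝ)
    (hγ : ContDiff ℝ (⊤ : ℕ∞) γ) (hT : ContDiff ℝ (⊤ : ℕ∞) T) (hN : ContDiff ℝ (⊤ : ℕ∞) N)
    (hB : ContDiff ℝ (⊤ : ℕ∞) B) (hκ : ContDiff ℝ (⊤ : ℕ∞) κ) (hτ : ContDiff ℝ (⊤ : ℕ∞) τ)
    (hΓTN : ContDiff ℝ (⊤ : ℕ∞) ΓTN) (hΓTB : ContDiff ℝ (⊤ : ℕ∞) ΓTB) (hΓNB : ContDiff ℝ (⊤ : ℕ∞) ΓNB)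
    (hΥTN : ContDiff ℝ (⊤ : ℕ∞) ΥTN) (hΥTB : ContDiff ℝ (⊤ : ℕ∞) ΥTB) (hΥNB : ContDiff ℝ (⊤ : ℕ∞) ΥNB)
    (hTT : ∀ p, pform v (T p) (T p) = ε₁)
    (hNN : ∀ p, pform v (N p) (N p) = ε₂)
    (hBB : ∀ p, pform v (B p) (B p) = ε₃)
    (hTN : ∀ p, pform v (T p) (N p) = 0)
    (hTB : ∀ p, pform v (T p) (B p) = 0)
    (hNB : ∀ p, pform v (N p) (B p) = 0)
    (hγT : ∀ p, pform v (γ p) (T p) = 0)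
    (hγN : ∀ p, pform v (γ p) (N p) = 0)
    (hγB : ∀ p, pform v (γ p) (B p) = 0)
    (hsT : ∀ p, pds T p = (-ε₁ * c) • γ p + (ε₂ * κ p) • N p)
    (hsN : ∀ p, pds N p = (-ε₁ * κ p) • T p + (ε₃ * τ p) • B p)
    (hsB : ∀ p, pds B p = (-ε₂ * τ p) • N p)
    (hxT : ∀ p, pdxi T p = (ε₂ * ΓTN p) • N p + (ε₃ * ΓTB p) • B p)
    (hxN : ∀ p, pdxi N p = (-ε₁ * ΓTN p) • T p + (ε₃ * ΓNB p) • B p)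
    (hxB : ∀ p, pdxi B p = (-ε₁ * ΓTB p) • T p + (-ε₂ * ΓNB p) • N p)
    (heT : ∀ p, pdeta T p = (ε₂ * ΥTN p) • N p + (ε₃ * ΥTB p) • B p)
    (heN : ∀ p, pdeta N p = (-ε₁ * ΥTN p) • T p + (ε₃ * ΥNB p) • B p)
    (heB : ∀ p, pdeta B p = (-ε₁ * ΥTB p) • T p + (-ε₂ * ΥNB p) • N p)
    (Es1 Es3 Exi1 Exi3 Eeta1 Eeta3 : ℝ × ℝ × ℝ → ℝ)
    (hEs1 : ∀ p : ℝ × ℝ × ℝ, HasDerivAt (fun t => Es1 (t, p.2.1, p.2.2)) 0 p.1)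
    (hEs3 : ∀ p : ℝ × ℝ × ℝ, HasDerivAt (fun t => Es3 (t, p.2.1, p.2.2)) 0 p.1)
    (hExi1 : ∀ p : ℝ × ℝ × ℝ, HasDerivAt (fun t => Exi1 (p.1, t, p.2.2)) 0 p.2.1)
    (hExi3 : ∀ p : ℝ × ℝ × ℝ, HasDerivAt (fun t => Exi3 (p.1, t, p.2.2)) 0 p.2.1)
    (hEeta1 : ∀ p : ℝ × ℝ × ℝ, HasDerivAt (fun t => Eeta1 (p.1, p.2.1, t)) 0 p.2.2)
    (hEeta3 : ∀ p : ℝ × ℝ × ℝ, HasDerivAt (fun t => Eeta3 (p.1, p.2.1, t)) 0 p.2.2)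
    :
    ∀ p : ℝ × ℝ × ℝ,
      pform v (T p) (pds (fun q => Es1 q • N q + Es3 q • B q) p)
        + pform v (N p) (pdxi (fun q => Exi1 q • N q + Exi3 q • B q) p)
        + pform v (B p) (pdeta (fun q => Eeta1 q • N q + Eeta3 q • B q) p)
      = -κ p * Es1 p + Eeta1 p * ΥNB p - Exi3 p * ΓNB p := by
  intro p
  have dN : Differentiable ℝ N := hN.differentiable (by simp)
  have dB : Differentiable ℝ B := hB.differentiable (by simp)
  have hs : pds (fun q => Es1 q • N q + Es3 q • B q) p
      = Es1 p • pds N p + Es3 p • pds B p :=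
    deriv_smul_add_smul_of_hasDerivAt_zero (hEs1 p) (hEs3 p) (by fun_prop) (by fun_prop)
  have hx : pdxi (fun q => Exi1 q • N q + Exi3 q • B q) p
      = Exi1 p • pdxi N p + Exi3 p • pdxi B p :=
    deriv_smul_add_smul_of_hasDerivAt_zero (hExi1 p) (hExi3 p) (by fun_prop) (by fun_prop)
  have he : pdeta (fun q => Eeta1 q • N q + Eeta3 q • B q) p
      = Eeta1 p • pdeta N p + Eeta3 p • pdeta B p :=
    deriv_smul_add_smul_of_hasDerivAt_zero (hEeta1 p) (hEeta3 p) (by fun_prop) (by fun_prop)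
  have sq₁ : ε₁ * ε₁ = 1 := mul_self_eq_one_iff.mpr hε₁
  have sq₂ : ε₂ * ε₂ = 1 := mul_self_eq_one_iff.mpr hε₂
  have sq₃ : ε₃ * ε₃ = 1 := mul_self_eq_one_iff.mpr hε₃
  rw [hs, hx, he, hsN, hsB, hxN, hxB, heN, heB]
  simp only [pform_add_right, pform_smul_right, pform_comm v (N p) (T p),
    pform_comm v (B p) (T p), pform_comm v (B p) (N p), hTT, hNN, hBB, hTN, hTB, hNB]
  linear_combination (-κ p * Es1 p) * sq₁ - (Exi3 p * ΓNB p) * sq₂ + (Eeta1 p * ΥNB p) * sq₃
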